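/- arXiv:2507.08503 — 2 statements merged into one kernel-verified Lean document; each statement's English description precedes it below -/
import Mathlib

section
/- For every integer n ≥ 4, the game isolation number of the cycle C_n satisfies: ι_g(C_n) = 2·⌈n/5⌉ if n ≡ 0 (mod 5), and ι_g(C_n) = 2·⌈n/5⌉ − 1 otherwise. -/
open SimpleGraph

variable {V : Type*}

/-- The closed neighborhood `N_G[X]` of a set `X` of vertices: all vertices that are in `X`
or adjacent to a vertex of `X`. -/
def closedNbhdSet (G : SimpleGraph V) (X : Set V) : Set V :=
  {u | u ∈ X ∨ ∃ x ∈ X, G.Adj x u}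

/-- A vertex `v` is playable with respect to the set `X` of already selected vertices if the
closed neighborhood of `v` contains a vertex `u ∉ N_G[X]` having a neighbor `w ∉ N_G[X]`,
i.e. `v` dominates a vertex of a nontrivial component of `G - N_G[X]`. -/
def IsPlayable (G : SimpleGraph V) (X : Set V) (v : V) : Prop :=
  ∃ u, (u = v ∨ G.Adj v u) ∧ u ∉ closedNbhdSet G X ∧
    ∃ w, G.Adj u w ∧ w ∉ closedNbhdSet G X

open Classical in
/-- The optimal-play value (number of further selected vertices) of the isolation game
position with given fuel, player to move (`true` = Dominator, the minimizer;
`false` = Staller, the maximizer) and set `X` of already selected vertices. -/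
noncomputable def isoGameVal (G : SimpleGraph V) : ℕ → Bool → Set V → ℕ
  | 0, _, _ => 0
  | (k + 1), isDom, X =>
    if ∃ v, IsPlayable G X v then
      (if isDom then sInf else sSup)
        {n : ℕ | ∃ v, IsPlayable G X v ∧ n = isoGameVal G k (!isDom) (insert v X) + 1}
    else 0

/-- The game isolation number `ι_g(G)`: the number of vertices selected in the isolation
game on `G` when Dominator moves first and both players play optimally.  (A game on a
graph with `n` vertices lasts at most `n` moves, so fuel `Fintype.card V` suffices.) -/
noncomputable def iotaGame (G : SimpleGraph V) [Fintype V] : ℕ :=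
  isoGameVal G (Fintype.card V) true ∅

/-- The Staller-start game isolation number `ι_g'(G)`: the number of vertices selected in
the isolation game on `G` when Staller moves first and both players play optimally. -/
noncomputable def iotaGame' (G : SimpleGraph V) [Fintype V] : ℕ :=
  isoGameVal G (Fintype.card V) false ∅

/-- The vertices `i` and `i + 1` are both undominated: the position `X` on a cycle still
contains the edge from `i` to `i + 1`. -/
def LiveEdge {m : ℕ} (X : Set (Fin (m + 5))) (i : Fin (m + 5)) : Prop :=
  i ∉ closedNbhdSet (cycleGraph (m + 5)) X ∧ i + 1 ∉ closedNbhdSet (cycleGraph (m + 5)) X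

open Classical in
/-- The number of edges between undominated vertices. -/
noncomputable def liveEdgeCount {m : ℕ} (X : Set (Fin (m + 5))) : ℕ :=
  ∑ i, if LiveEdge X i then 1 else 0

open Classical in
/-- The number of edges between undominated vertices plus three times the number of
nontrivial components of the undominated part (each counted at its first edge). -/
noncomputable def runWeight {m : ℕ} (X : Set (Fin (m + 5))) : ℕ :=
  ∑ i, if LiveEdge X i then (if LiveEdge X (i - 1) then 1 else 4) else 0

section Game

variable (G : SimpleGraph V)

lemma isoGameVal_le_fuel (k : ℕ) (b : Bool) (X : Set V) : isoGameVal G k b X ≤ k := by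
  induction k generalizing b X with
  | zero => simp [isoGameVal]
  | succ k ih =>
    rw [isoGameVal]
    split_ifs with h hb
    · obtain ⟨v, hv⟩ := h
      exact le_trans (Nat.sInf_le ⟨v, hv, rfl⟩) (Nat.succ_le_succ (ih _ _))
    · obtain ⟨v, hv⟩ := h
      refine csSup_le ⟨_, v, hv, rfl⟩ ?_
      rintro _ ⟨w, -, rfl⟩
      exact Nat.succ_le_succ (ih _ _)
    · exact Nat.zero_le _

variable {G}

lemma isoGameVal_of_not_playable {X : Set V} (h : ¬ ∃ v, IsPlayable G X v) (k : ℕ) (b : Bool) :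
    isoGameVal G k b X = 0 := by
  cases k with
  | zero => rfl
  | succ k => rw [isoGameVal, if_neg h]

lemma isoGameVal_dominator_le {X : Set V} {v : V} (hv : IsPlayable G X v) (k : ℕ) :
    isoGameVal G (k + 1) true X ≤ isoGameVal G k false (insert v X) + 1 := by
  rw [isoGameVal, if_pos ⟨v, hv⟩]
  exact Nat.sInf_le ⟨v, hv, rfl⟩

lemma le_isoGameVal_dominator {X : Set V} {k c : ℕ} (h : ∃ v, IsPlayable G X v)
    (hc : ∀ v, IsPlayable G X v → c ≤ isoGameVal G k false (insert v X) + 1) :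
    c ≤ isoGameVal G (k + 1) true X := by
  rw [isoGameVal, if_pos h]
  obtain ⟨v, hv⟩ := h
  refine le_csInf ⟨_, v, hv, rfl⟩ ?_
  rintro _ ⟨w, hw, rfl⟩
  exact hc w hw

lemma le_isoGameVal_staller {X : Set V} {v : V} (hv : IsPlayable G X v) (k : ℕ) :
    isoGameVal G k true (insert v X) + 1 ≤ isoGameVal G (k + 1) false X := by
  rw [isoGameVal, if_pos ⟨v, hv⟩]
  refine le_csSup ⟨k + 1, ?_⟩ ⟨v, hv, rfl⟩
  rintro _ ⟨w, -, rfl⟩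
  exact Nat.succ_le_succ (isoGameVal_le_fuel _ _ _ _)

lemma isoGameVal_staller_le {X : Set V} {k c : ℕ} (h : ∃ v, IsPlayable G X v)
    (hc : ∀ v, IsPlayable G X v → isoGameVal G k true (insert v X) + 1 ≤ c) :
    isoGameVal G (k + 1) false X ≤ c := by
  rw [isoGameVal, if_pos h]
  obtain ⟨v, hv⟩ := h
  refine csSup_le ⟨_, v, hv, rfl⟩ ?_
  rintro _ ⟨w, hw, rfl⟩
  exact hc w hw

end Game

section Cycle

variable {m : ℕ} {X : Set (Fin (m + 5))}

lemma cycleGraph_adj_iff (u v : Fin (m + 5)) :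
    (cycleGraph (m + 5)).Adj u v ↔ u = v + 1 ∨ v = u + 1 := by
  rw [cycleGraph_adj, sub_eq_iff_eq_add', sub_eq_iff_eq_add']

lemma mem_closedNbhdSet_cycleGraph (u : Fin (m + 5)) :
    u ∈ closedNbhdSet (cycleGraph (m + 5)) X ↔ u ∈ X ∨ u + 1 ∈ X ∨ u - 1 ∈ X := by
  simp only [closedNbhdSet, Set.mem_ofPred_eq, cycleGraph_adj_iff]
  constructor
  · rintro (h | ⟨x, hx, rfl | rfl⟩)
    · exact Or.inl h
    · exact Or.inr (Or.inl hx)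
    · exact Or.inr (Or.inr (by simpa using hx))
  · rintro (h | h | h)
    · exact Or.inl h
    · exact Or.inr ⟨_, h, Or.inl rfl⟩
    · exact Or.inr ⟨_, h, Or.inr (by simp)⟩

/-- Selecting `a + 2` destroys exactly the four edges starting at `a, …, a + 3`. -/
lemma liveEdge_insert (a i : Fin (m + 5)) :
    LiveEdge (insert (a + 1 + 1) X) i ↔
      LiveEdge X i ∧ i ≠ a ∧ i ≠ a + 1 ∧ i ≠ a + 1 + 1 ∧ i ≠ a + 1 + 1 + 1 := by
  simp only [LiveEdge, mem_closedNbhdSet_cycleGraph, Set.mem_insert_iff, sub_eq_iff_eq_add,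
    add_left_inj, add_sub_cancel_right]
  tauto

/-- A vertex is playable iff selecting it destroys an edge. -/
lemma isPlayable_iff (a : Fin (m + 5)) :
    IsPlayable (cycleGraph (m + 5)) X (a + 1 + 1) ↔
      LiveEdge X a ∨ LiveEdge X (a + 1) ∨ LiveEdge X (a + 1 + 1) ∨
        LiveEdge X (a + 1 + 1 + 1) := by
  simp only [IsPlayable, LiveEdge, cycleGraph_adj_iff, add_left_inj]
  constructor
  · rintro ⟨u, h, hu, w, h', hw⟩
    rw [eq_comm (a := a + 1)] at h
    rcases h with rfl | rfl | rfl <;> rcases h' with h' | rfl <;>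
      (try rw [add_left_inj] at h'; subst h') <;> simp [hu, hw]
  · rintro (⟨h, h'⟩ | ⟨h, h'⟩ | ⟨h, h'⟩ | ⟨h, h'⟩)
    · exact ⟨_, by tauto, h', _, Or.inl rfl, h⟩
    · exact ⟨_, by tauto, h, _, Or.inr rfl, h'⟩
    · exact ⟨_, by tauto, h, _, Or.inr rfl, h'⟩
    · exact ⟨_, by tauto, h, _, Or.inr rfl, h'⟩

lemma exists_eq_add_two (v : Fin (m + 5)) : ∃ a, v = a + 1 + 1 := ⟨v - 1 - 1, by simp⟩

lemma exists_isPlayable_iff :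
    (∃ v, IsPlayable (cycleGraph (m + 5)) X v) ↔ ∃ i, LiveEdge X i := by
  constructor
  · rintro ⟨v, hv⟩
    obtain ⟨a, rfl⟩ := exists_eq_add_two v
    rw [isPlayable_iff] at hv
    rcases hv with h | h | h | h <;> exact ⟨_, h⟩
  · rintro ⟨i, hi⟩
    exact ⟨_, (isPlayable_iff i).2 (Or.inl hi)⟩

lemma small_multiples_ne_zero (m : ℕ) : (1 : Fin (m + 5)) ≠ 0 ∧ (1 + 1 : Fin (m + 5)) ≠ 0 ∧
    (1 + (1 + 1) : Fin (m + 5)) ≠ 0 ∧ (1 + (1 + (1 + 1)) : Fin (m + 5)) ≠ 0 := by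
  have h2 : 2 % (m + 5) = 2 := Nat.mod_eq_of_lt (by omega)
  have h3 : 3 % (m + 5) = 3 := Nat.mod_eq_of_lt (by omega)
  have h4 : 4 % (m + 5) = 4 := Nat.mod_eq_of_lt (by omega)
  simp [Fin.ext_iff, Fin.val_add, h2, h3, h4]

/-- Two functions that differ only on five consecutive vertices. -/
lemma sum_add_window {f g : Fin (m + 5) → ℕ} (a : Fin (m + 5))
    (h : ∀ i, i ≠ a → i ≠ a + 1 → i ≠ a + 1 + 1 → i ≠ a + 1 + 1 + 1 →
      i ≠ a + 1 + 1 + 1 + 1 → f i = g i) :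
    ∑ i, f i + (g a + g (a + 1) + g (a + 1 + 1) + g (a + 1 + 1 + 1) + g (a + 1 + 1 + 1 + 1)) =
    ∑ i, g i + (f a + f (a + 1) + f (a + 1 + 1) + f (a + 1 + 1 + 1) + f (a + 1 + 1 + 1 + 1)) := by
  obtain ⟨h1, h2, h3, h4⟩ := small_multiples_ne_zero m
  let S : Finset (Fin (m + 5)) :=
    {a, a + 1, a + 1 + 1, a + 1 + 1 + 1, a + 1 + 1 + 1 + 1}
  have hS (F : Fin (m + 5) → ℕ) : ∑ i ∈ S, F i =
      F a + F (a + 1) + F (a + 1 + 1) + F (a + 1 + 1 + 1) + F (a + 1 + 1 + 1 + 1) := by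
    simp only [S]
    repeat rw [Finset.sum_insert (by simp [add_assoc, h1, h2, h3, h4])]
    rw [Finset.sum_singleton]
    ring
  have hc : ∑ i ∈ Sᶜ, f i = ∑ i ∈ Sᶜ, g i := by
    refine Finset.sum_congr rfl fun i hi => ?_
    simp only [S, Finset.mem_compl, Finset.mem_insert, Finset.mem_singleton, not_or] at hi
    exact h i hi.1 hi.2.1 hi.2.2.1 hi.2.2.2.1 hi.2.2.2.2
  rw [← hS, ← hS, ← Finset.sum_add_sum_compl S f, ← Finset.sum_add_sum_compl S g, hc]
  ring

lemma liveEdge_insert_window (a : Fin (m + 5)) :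
    ¬ LiveEdge (insert (a + 1 + 1) X) a ∧ ¬ LiveEdge (insert (a + 1 + 1) X) (a + 1) ∧
    ¬ LiveEdge (insert (a + 1 + 1) X) (a + 1 + 1) ∧
    ¬ LiveEdge (insert (a + 1 + 1) X) (a + 1 + 1 + 1) ∧
    (LiveEdge (insert (a + 1 + 1) X) (a + 1 + 1 + 1 + 1) ↔
      LiveEdge X (a + 1 + 1 + 1 + 1)) := by
  obtain ⟨h1, h2, h3, h4⟩ := small_multiples_ne_zero m
  simp only [liveEdge_insert]
  refine ⟨by tauto, by tauto, by tauto, by tauto, ?_⟩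
  simp [add_assoc, h1, h2, h3, h4]

open Classical in
lemma liveEdgeCount_insert (a : Fin (m + 5)) :
    liveEdgeCount X = liveEdgeCount (insert (a + 1 + 1) X) +
      ((if LiveEdge X a then 1 else 0) + (if LiveEdge X (a + 1) then 1 else 0) +
        (if LiveEdge X (a + 1 + 1) then 1 else 0) +
        (if LiveEdge X (a + 1 + 1 + 1) then 1 else 0)) := by
  obtain ⟨h0, h1, h2, h3, h4⟩ := liveEdge_insert_window (X := X) a
  have key := sum_add_window (f := fun i => if LiveEdge X i then 1 else 0)
    (g := fun i => if LiveEdge (insert (a + 1 + 1) X) i then 1 else 0) a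
    (fun i _ _ _ _ _ => by simp only [liveEdge_insert]; congr 1; simp [*])
  simp only [h0, h1, h2, h3, h4, if_false] at key
  unfold liveEdgeCount
  omega

open Classical in
lemma runWeight_insert (a : Fin (m + 5)) :
    runWeight X + (if LiveEdge X (a + 1 + 1 + 1 + 1) then 4 else 0) =
      runWeight (insert (a + 1 + 1) X) +
      ((if LiveEdge X a then (if LiveEdge X (a - 1) then 1 else 4) else 0) +
        (if LiveEdge X (a + 1) then (if LiveEdge X a then 1 else 4) else 0) +
        (if LiveEdge X (a + 1 + 1) then (if LiveEdge X (a + 1) then 1 else 4) else 0) +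
        (if LiveEdge X (a + 1 + 1 + 1) then
          (if LiveEdge X (a + 1 + 1) then 1 else 4) else 0) +
        (if LiveEdge X (a + 1 + 1 + 1 + 1) then
          (if LiveEdge X (a + 1 + 1 + 1) then 1 else 4) else 0)) := by
  obtain ⟨h0, h1, h2, h3, h4⟩ := liveEdge_insert_window (X := X) a
  have key := sum_add_window
    (f := fun i => if LiveEdge X i then (if LiveEdge X (i - 1) then 1 else 4) else 0)
    (g := fun i => if LiveEdge (insert (a + 1 + 1) X) i then
      (if LiveEdge (insert (a + 1 + 1) X) (i - 1) then 1 else 4) else 0) a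
    (fun i _ _ _ _ _ => by
      simp only [liveEdge_insert, ne_eq, sub_eq_iff_eq_add]; simp [*])
  simp only [h0, h1, h2, h3, h4, if_false, add_sub_cancel_right] at key
  unfold runWeight
  omega

/-- Some run of undominated vertices has a first edge, once a vertex has been selected. -/
lemma exists_first_liveEdge (hX : X.Nonempty) (h : ∃ i, LiveEdge X i) :
    ∃ i, LiveEdge X (i + 1) ∧ ¬ LiveEdge X i := by
  by_contra! hcon
  obtain ⟨i, hi⟩ := h
  obtain ⟨x, hx⟩ := hX
  have back (k : ℕ) : LiveEdge X (i - k • 1) := by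
    induction k with
    | zero => simpa using hi
    | succ k ih =>
      refine hcon _ ?_
      rwa [succ_nsmul, sub_add_eq_sub_sub, sub_add_cancel]
  have hb := (back (i - x).val).1
  rw [mem_closedNbhdSet_cycleGraph] at hb
  have : (i - x).val • (1 : Fin (m + 5)) = i - x := by
    open Fin.CommRing in rw [nsmul_one, Fin.cast_val_eq_self]
  rw [this, sub_sub_cancel] at hb
  exact hb (Or.inl hx)

lemma liveEdgeCount_eq_zero (h : ¬ ∃ i, LiveEdge X i) : liveEdgeCount X = 0 := by
  push Not at h
  simp [liveEdgeCount, h]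

lemma liveEdgeCount_le_insert (v : Fin (m + 5)) :
    liveEdgeCount X ≤ liveEdgeCount (insert v X) + 4 := by
  obtain ⟨a, rfl⟩ := exists_eq_add_two v
  rw [liveEdgeCount_insert a]
  split_ifs <;> omega

/-- Staller can always move so that only one edge is destroyed. -/
lemma exists_playable_liveEdgeCount (hX : X.Nonempty) (h : ∃ i, LiveEdge X i) :
    ∃ v, IsPlayable (cycleGraph (m + 5)) X v ∧
      liveEdgeCount X ≤ liveEdgeCount (insert v X) + 1 := by
  obtain ⟨i, hi, hi'⟩ := exists_first_liveEdge hX h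
  obtain ⟨a, rfl⟩ := exists_eq_add_two i
  refine ⟨a + 1 + 1, (isPlayable_iff a).2 (by tauto), ?_⟩
  have hdom : a + 1 + 1 ∈ closedNbhdSet (cycleGraph (m + 5)) X := by
    by_contra hc
    exact hi' ⟨hc, hi.1⟩
  have hdom' : a + 1 ∈ closedNbhdSet (cycleGraph (m + 5)) X := by
    have := hi.1
    simp only [mem_closedNbhdSet_cycleGraph, add_sub_cancel_right] at this hdom ⊢
    tauto
  have h0 : ¬ LiveEdge X a := fun hc => hc.2 hdom'
  have h1 : ¬ LiveEdge X (a + 1) := fun hc => hc.1 hdom'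
  rw [liveEdgeCount_insert a]
  simp [h0, h1, hi, hi']

/-- Every move decreases the weight. -/
lemma runWeight_insert_lt {v : Fin (m + 5)} (hv : IsPlayable (cycleGraph (m + 5)) X v) :
    runWeight (insert v X) + 1 ≤ runWeight X := by
  obtain ⟨a, rfl⟩ := exists_eq_add_two v
  rw [isPlayable_iff] at hv
  have key := runWeight_insert (X := X) a
  by_cases h0 : LiveEdge X a <;> by_cases h1 : LiveEdge X (a + 1) <;>
  by_cases h2 : LiveEdge X (a + 1 + 1) <;> by_cases h3 : LiveEdge X (a + 1 + 1 + 1) <;>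
  simp only [h0, h1, h2, h3, if_true, if_false, or_self] at key hv <;>
  split_ifs at key <;> omega

/-- Dominator can always decrease the weight by at least four. -/
lemma exists_playable_runWeight (hX : X.Nonempty) (h : ∃ i, LiveEdge X i) :
    ∃ v, IsPlayable (cycleGraph (m + 5)) X v ∧ runWeight (insert v X) + 4 ≤ runWeight X := by
  obtain ⟨i, hi, hi'⟩ := exists_first_liveEdge hX h
  refine ⟨i + 1 + 1 + 1, (isPlayable_iff (i + 1)).2 (Or.inl hi), ?_⟩
  have key := runWeight_insert (X := X) (i + 1)
  rw [add_sub_cancel_right] at key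
  generalize i + 1 = a at *
  simp only [hi, hi', if_true, if_false] at key
  by_cases h1 : LiveEdge X (a + 1) <;>
  by_cases h2 : LiveEdge X (a + 1 + 1) <;> by_cases h3 : LiveEdge X (a + 1 + 1 + 1) <;>
  simp only [h1, h2, h3, if_true, if_false] at key <;>
  split_ifs at key <;> omega

lemma le_isoGameVal_cycleGraph (k : ℕ) (b : Bool) (hX : b = true ∨ X.Nonempty) :
    min k ((liveEdgeCount X + 4) / 5 +
      (if b then liveEdgeCount X else liveEdgeCount X + 3) / 5) ≤
      isoGameVal (cycleGraph (m + 5)) k b X := by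
  induction k generalizing b X with
  | zero => simp
  | succ k ih =>
    by_cases h : ∃ i, LiveEdge X i
    · cases b with
      | true =>
        refine le_isoGameVal_dominator (exists_isPlayable_iff.2 h) fun v _ => ?_
        have := ih (X := insert v X) false (Or.inr (Set.insert_nonempty _ _))
        have := liveEdgeCount_le_insert (X := X) v
        simp only [Bool.false_eq_true, if_false, if_true] at *
        omega
      | false =>
        obtain ⟨v, hv, hle⟩ := exists_playable_liveEdgeCount (by simpa using hX) h
        refine le_trans ?_ (le_isoGameVal_staller hv k)
        have := ih (X := insert v X) true (Or.inl rfl)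
        simp only [Bool.false_eq_true, if_false, if_true] at *
        omega
    · rw [liveEdgeCount_eq_zero h]
      split_ifs <;> simp

lemma isoGameVal_cycleGraph_le (k : ℕ) (b : Bool) (hX : X.Nonempty) :
    isoGameVal (cycleGraph (m + 5)) k b X ≤
      if b then (runWeight X + 1) / 5 + (runWeight X + 2) / 5 - 1
      else runWeight X / 5 + (runWeight X + 1) / 5 := by
  induction k generalizing b X with
  | zero => simp [isoGameVal]
  | succ k ih =>
    by_cases h : ∃ i, LiveEdge X i
    · obtain ⟨v, hv, hle⟩ := exists_playable_runWeight hX h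
      cases b with
      | true =>
        refine (isoGameVal_dominator_le hv k).trans ?_
        have := ih (X := insert v X) false (Set.insert_nonempty _ _)
        simp only [Bool.false_eq_true, if_false, if_true] at *
        omega
      | false =>
        refine isoGameVal_staller_le ⟨v, hv⟩ fun w hw => ?_
        have := ih (X := insert w X) true (Set.insert_nonempty _ _)
        have := runWeight_insert_lt hw
        simp only [Bool.false_eq_true, if_false, if_true] at *
        omega
    · rw [isoGameVal_of_not_playable (mt exists_isPlayable_iff.1 h)]
      exact Nat.zero_le _

lemma liveEdge_empty (i : Fin (m + 5)) : LiveEdge ∅ i := by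
  simp [LiveEdge, mem_closedNbhdSet_cycleGraph]

lemma iotaGame_cycleGraph_add_five (m : ℕ) :
    iotaGame (cycleGraph (m + 5)) = (m + 5 + 4) / 5 + (m + 5) / 5 := by
  have hW : liveEdgeCount (∅ : Set (Fin (m + 5))) = m + 5 := by
    simp [liveEdgeCount, liveEdge_empty]
  have hP : runWeight (∅ : Set (Fin (m + 5))) = m + 5 := by
    simp [runWeight, liveEdge_empty]
  rw [iotaGame, Fintype.card_fin]
  apply le_antisymm
  · obtain ⟨v, hv⟩ := exists_isPlayable_iff.2 ⟨(0 : Fin (m + 5)), liveEdge_empty 0⟩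
    have h1 : isoGameVal _ (m + 5) _ _ ≤ _ := isoGameVal_dominator_le hv (m + 4)
    have h2 := isoGameVal_cycleGraph_le (m + 4) false (Set.insert_nonempty v ∅)
    have h3 := runWeight_insert_lt hv
    simp only [Bool.false_eq_true, if_false] at h2
    omega
  · have := le_isoGameVal_cycleGraph (X := (∅ : Set (Fin (m + 5)))) (m + 5) true (Or.inl rfl)
    rw [hW, if_pos rfl] at this
    omega

end Cycle

lemma not_isPlayable_cycleGraph_four (v w : Fin 4) :
    ¬ IsPlayable (cycleGraph 4) (insert v ∅) w := by
  simp only [IsPlayable, closedNbhdSet, cycleGraph_adj, Set.mem_insert_iff,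
    Set.mem_empty_iff_false, or_false, Set.mem_ofPred_eq, exists_eq_left]
  revert v w
  decide

lemma iotaGame_cycleGraph_four : iotaGame (cycleGraph 4) = 1 := by
  have hv : IsPlayable (cycleGraph 4) ∅ 0 :=
    ⟨0, Or.inl rfl, by simp [closedNbhdSet], 1, by simp [cycleGraph_adj],
      by simp [closedNbhdSet]⟩
  rw [iotaGame, Fintype.card_fin]
  apply le_antisymm
  · refine (isoGameVal_dominator_le hv 3).trans ?_
    rw [isoGameVal_of_not_playable (by simpa using not_isPlayable_cycleGraph_four 0)]
  · exact le_isoGameVal_dominator ⟨0, hv⟩ fun _ _ => Nat.le_add_left _ _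

/-- Theorem 1.3 (D-game part): for `n ≥ 4`, `ι_g(C_n) = 2⌈n/5⌉` if `5 ∣ n` and
`ι_g(C_n) = 2⌈n/5⌉ - 1` otherwise.  (In ℕ, `⌈n/5⌉ = (n + 4) / 5`.) -/
theorem game_isolation_number_cycle (n : ℕ) (hn : 4 ≤ n) :
    iotaGame (SimpleGraph.cycleGraph n) =
      if n % 5 = 0 then 2 * ((n + 4) / 5) else 2 * ((n + 4) / 5) - 1 := by
  obtain rfl | ⟨m, rfl⟩ : n = 4 ∨ ∃ m, n = m + 5 :=
    hn.eq_or_lt.imp Eq.symm fun h => ⟨n - 5, by omega⟩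
  · exact iotaGame_cycleGraph_four
  · rw [iotaGame_cycleGraph_add_five]
    split_ifs <;> omega
end

section
/- Let n ≥ 6 be an integer with n ≡ 0 (mod 5) or n ≡ 4 (mod 5). Then ι_g(P_n) = ⌈2n/5⌉ − 1 and ι_g'(P_n) = ⌊(2n+2)/5⌋. -/
open SimpleGraph

variable {V : Type*}

namespace PathIsolation

/-- The weight, in eighths of a move, of a maximal run of `m` consecutive undominated vertices. -/
def runWeight (m : ℕ) : ℕ :=
  16 * ((m - 1) / 5) +
    (if (m - 1) % 5 = 0 then 0 else if (m - 1) % 5 = 1 then 8 else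
      if (m - 1) % 5 = 2 then 12 else if (m - 1) % 5 = 3 then 14 else 15)

/-- A power of two dividing `runWeight m`; the smaller it is, the more urgent the run. -/
def runGrain (m : ℕ) : ℕ :=
  if m % 5 = 0 then 1 else if m % 5 = 4 then 2 else if m % 5 = 3 then 4 else 8

lemma runWeight_add_six (m : ℕ) : runWeight (m + 6) = runWeight (m + 1) + 16 := by
  have h1 : (m + 6 - 1) / 5 = (m + 1 - 1) / 5 + 1 := by omega
  have h2 : (m + 6 - 1) % 5 = (m + 1 - 1) % 5 := by omega
  rw [runWeight, runWeight, h1, h2]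
  ring

lemma runWeight_split_inner (x y : ℕ) :
    runWeight x + runWeight y < runWeight (x + y + 3) ∧
      runWeight (x + y + 3) < runWeight x + runWeight y + 16 := by
  induction x using Nat.strong_induction_on generalizing y with
  | _ x ihx =>
    induction y using Nat.strong_induction_on with
    | _ y ihy =>
      by_cases hx : 6 ≤ x
      · obtain ⟨x, rfl⟩ := Nat.exists_eq_add_of_le' hx
        have h := ihx (x + 1) (by omega) y
        have e := runWeight_add_six (x + y + 3)
        rw [show x + 1 + y + 3 = x + y + 3 + 1 by ring] at h
        rw [show x + 6 + y + 3 = x + y + 3 + 6 by ring, runWeight_add_six, runWeight_add_six]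
        omega
      · by_cases hy : 6 ≤ y
        · obtain ⟨y, rfl⟩ := Nat.exists_eq_add_of_le' hy
          have h := ihy (y + 1) (by omega)
          rw [show x + (y + 1) + 3 = x + y + 3 + 1 by ring] at h
          rw [show x + (y + 6) + 3 = x + y + 3 + 6 by ring, runWeight_add_six, runWeight_add_six]
          omega
        · have small : ∀ x < 6, ∀ y < 6, runWeight x + runWeight y < runWeight (x + y + 3) ∧
              runWeight (x + y + 3) < runWeight x + runWeight y + 16 := by decide
          exact small x (by omega) y (by omega)

lemma runWeight_split_end {m x : ℕ} (hm : 2 ≤ m) (h : x + 1 = m ∨ x + 2 = m) :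
    runWeight x < runWeight m ∧ runWeight m < runWeight x + 16 := by
  unfold runWeight
  rcases h with rfl | rfl <;> split_ifs <;> omega

lemma runWeight_split {m x y : ℕ} (hm : 2 ≤ m)
    (h : x + y + 3 = m ∨ (x = 0 ∧ (y + 1 = m ∨ y + 2 = m)) ∨ (y = 0 ∧ (x + 1 = m ∨ x + 2 = m))) :
    runWeight x + runWeight y < runWeight m ∧
      runWeight m < runWeight x + runWeight y + 16 := by
  have h0 : runWeight 0 = 0 := rfl
  rcases h with rfl | ⟨rfl, h⟩ | ⟨rfl, h⟩
  · exact runWeight_split_inner x y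
  · simpa [h0] using runWeight_split_end hm h
  · simpa [h0] using runWeight_split_end hm h

lemma runWeight_sub_four {m : ℕ} (hm : 2 ≤ m) :
    runWeight (m - 4) + 16 ≤ runWeight m + runGrain m := by
  unfold runWeight runGrain
  split_ifs <;> omega

lemma runWeight_pred {m : ℕ} (hm : 2 ≤ m) :
    runWeight m ≤ runWeight (m - 1) + runGrain m := by
  unfold runWeight runGrain
  split_ifs <;> omega

lemma runWeight_mono_succ (m : ℕ) : runWeight m ≤ runWeight (m + 1) := by
  unfold runWeight
  split_ifs <;> omega

lemma runWeight_of_le_one {m : ℕ} (hm : m ≤ 1) : runWeight m = 0 := by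
  interval_cases m <;> rfl

lemma runGrain_cases (m : ℕ) :
    runGrain m = 1 ∨ runGrain m = 2 ∨ runGrain m = 4 ∨ runGrain m = 8 := by
  unfold runGrain
  split_ifs <;> omega

lemma runGrain_dvd_runWeight {m : ℕ} (hm : 2 ≤ m) : runGrain m ∣ runWeight m := by
  unfold runWeight runGrain
  split_ifs <;> omega

open Classical in
/-- The number of consecutive elements of `U` ending at `i`. -/
noncomputable def runLength (U : Set ℕ) : ℕ → ℕ
  | 0 => 0
  | i + 1 => if i + 1 ∈ U then runLength U i + 1 else 0

open Classical in
/-- The total weight of the runs of `U` within `{1, …, i}`. -/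
noncomputable def weight (U : Set ℕ) : ℕ → ℕ
  | 0 => 0
  | i + 1 =>
    if i + 1 ∈ U then
      weight U i + (runWeight (runLength U i + 1) - runWeight (runLength U i))
    else weight U i

/-- The open interval between `a` and `b` is a maximal run of `U`. -/
structure IsRun (U : Set ℕ) (a b : ℕ) : Prop where
  left : a ∉ U
  right : b ∉ U
  lt : a < b
  mem : ∀ j, a < j → j < b → j ∈ U

lemma runLength_of_notMem {U : Set ℕ} {i : ℕ} (h : i ∉ U) : runLength U i = 0 := by
  cases i with
  | zero => rfl
  | succ i => simp [runLength, h]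

lemma weight_add {U : Set ℕ} {a : ℕ} (ha : a ∉ U) (j : ℕ)
    (h : ∀ i, a < i → i ≤ a + j → i ∈ U) :
    runLength U (a + j) = j ∧ weight U (a + j) = weight U a + runWeight j := by
  induction j with
  | zero => exact ⟨runLength_of_notMem ha, by simp [runWeight]⟩
  | succ j ih =>
    obtain ⟨h1, h2⟩ := ih fun i hi hj => h i hi (by omega)
    have hm : a + j + 1 ∈ U := h _ (by omega) (by omega)
    have := runWeight_mono_succ j
    rw [← add_assoc]
    simp only [runLength, weight, hm, if_true, h1, h2, true_and]
    omega

lemma weight_succ_of_notMem {U : Set ℕ} {i : ℕ} (h : i + 1 ∉ U) :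
    weight U (i + 1) = weight U i := by
  simp [weight, h]

lemma IsRun.weight_eq {U : Set ℕ} {a b : ℕ} (h : IsRun U a b) :
    weight U b = weight U a + runWeight (b - a - 1) := by
  have hlt := h.lt
  obtain ⟨j, rfl⟩ : ∃ j, b = a + j + 1 := ⟨b - a - 1, by omega⟩
  rw [weight_succ_of_notMem h.right,
    (weight_add h.left j fun i hi hj => h.mem i hi (by omega)).2]
  congr 2
  omega

lemma weight_congr {U U' : Set ℕ} {c : ℕ} (hc : c ∉ U) (hc' : c ∉ U') (d : ℕ)
    (h : ∀ i, c < i → i ≤ c + d → (i ∈ U ↔ i ∈ U')) :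
    runLength U (c + d) = runLength U' (c + d) ∧
      weight U (c + d) + weight U' c = weight U' (c + d) + weight U c := by
  induction d with
  | zero =>
    exact ⟨by rw [add_zero, runLength_of_notMem hc, runLength_of_notMem hc'], add_comm _ _⟩
  | succ d ih =>
    obtain ⟨h1, h2⟩ := ih fun i hi hj => h i hi (by omega)
    have hm := h (c + d + 1) (by omega) (by omega)
    rw [← add_assoc]
    by_cases hU : c + d + 1 ∈ U
    · simp only [runLength, weight, hU, hm.1 hU, if_true, h1, true_and]
      omega
    · simp only [runLength, weight, hU, mt hm.2 hU, if_false, true_and]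
      exact h2

lemma exists_run {U : Set ℕ} {N i : ℕ} (h0 : 0 ∉ U) (hN : ∀ j, N ≤ j → j ∉ U) (hi : i ∈ U) :
    ∃ a b, IsRun U a b ∧ a < i ∧ i < b ∧ b ≤ N := by
  classical
  have hl : ∀ k ∈ U, ∃ a < k, a ∉ U ∧ ∀ j, a < j → j ≤ k → j ∈ U := by
    intro k
    induction k with
    | zero => exact fun h => absurd h h0
    | succ k ih =>
      intro hk
      by_cases hk' : k ∈ U
      · obtain ⟨a, h1, h2, h3⟩ := ih hk'
        refine ⟨a, by omega, h2, fun j hj hjk => ?_⟩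
        rcases Nat.lt_or_ge k j with hlt | hle
        · obtain rfl : j = k + 1 := by omega
          exact hk
        · exact h3 j hj hle
      · refine ⟨k, by omega, hk', fun j hj hjk => ?_⟩
        obtain rfl : j = k + 1 := by omega
        exact hk
  obtain ⟨a, ha, haU, hmem⟩ := hl i hi
  have hiN : i < N := by
    by_contra hc
    exact hN i (by omega) hi
  have hex : ∃ b, i ≤ b ∧ b ∉ U := ⟨N, hiN.le, hN N le_rfl⟩
  have hspec := Nat.find_spec hex
  have hne : Nat.find hex ≠ i := fun h => hspec.2 (by rw [h]; exact hi)
  refine ⟨a, Nat.find hex, ⟨haU, hspec.2, by omega, fun j hj hjb => ?_⟩, ha, by omega,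
    Nat.find_min' hex ⟨hiN.le, hN N le_rfl⟩⟩
  rcases Nat.lt_or_ge i j with hlt | hle
  · by_contra hc
    exact Nat.find_min hex hjb ⟨hlt.le, hc⟩
  · exact hmem j hj hle

lemma dvd_weight {U : Set ℕ} {g : ℕ} (h0 : 0 ∉ U) (N : ℕ) (hN : N ∉ U)
    (h : ∀ a b, IsRun U a b → b ≤ N → g ∣ runWeight (b - a - 1)) : g ∣ weight U N := by
  induction N using Nat.strong_induction_on with
  | _ N ih =>
    rcases Nat.eq_zero_or_pos N with rfl | hpos
    · exact dvd_zero g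
    · obtain ⟨a, ha⟩ : ∃ a, IsRun U a N := by
        by_cases hm : N - 1 ∈ U
        · obtain ⟨a, b, hab, h1, h2, h3⟩ :=
            exists_run (U := U ∩ Set.Iio N) (N := N) (fun h => h0 h.1)
              (fun j hj hjU => absurd hjU.2 (by simpa using hj)) ⟨hm, by simp; omega⟩
          obtain rfl : b = N := by omega
          refine ⟨a, fun h => hab.left ⟨h, ?_⟩, hN, hab.lt, fun j hj hjb => (hab.mem j hj hjb).1⟩
          exact hab.lt
        · exact ⟨N - 1, hm, hN, by omega, fun j hj hjb => by omega⟩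
      rw [ha.weight_eq]
      have hlt := ha.lt
      exact dvd_add (ih a hlt ha.left fun c d hcd hd => h c d hcd (by omega)) (h a N ha le_rfl)

/-- Playing the position `p` in the closure of a run splits this run and affects no other. -/
lemma IsRun.weight_split {U U' : Set ℕ} {a b p N : ℕ} (hab : IsRun U a b) (h3 : a + 3 ≤ b)
    (hsep : ∀ i, i ∈ U → i + 2 ∈ U → i + 1 ∈ U)
    (h0 : 0 ∉ U) (hap : a ≤ p) (hpb : p ≤ b) (hbN : b ≤ N)
    (hU' : ∀ i, i ∈ U' ↔ i ∈ U ∧ (i + 1 < p ∨ p + 1 < i)) :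
    weight U N + (runWeight (p - 2 - a) + runWeight (b - p - 2)) =
      weight U' N + runWeight (b - a - 1) := by
  have ha' : a ∉ U' := fun h => hab.left ((hU' a).1 h).1
  have hb' : b ∉ U' := fun h => hab.right ((hU' b).1 h).1
  have h0' : 0 ∉ U' := fun h => h0 ((hU' 0).1 h).1
  have hpre : weight U a = weight U' a := by
    have := (weight_congr h0 h0' a fun i _ hi => ?_).2
    · simpa [weight] using this
    · rw [hU']
      refine ⟨fun h => ⟨h, ?_⟩, And.left⟩
      by_contra hc
      have hia : i ≠ a := fun h' => hab.left (h' ▸ h)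
      obtain rfl : a = i + 1 := by omega
      exact hab.left (hsep i h (hab.mem _ (by omega) (by omega)))
  have hsuf : weight U N + weight U' b = weight U' N + weight U b := by
    have := (weight_congr hab.right hb' (N - b) fun i hi _ => ?_).2
    · rwa [Nat.add_sub_cancel' hbN] at this
    · rw [hU']
      refine ⟨fun h => ⟨h, ?_⟩, And.left⟩
      by_contra hc
      obtain ⟨c, rfl⟩ : ∃ c, b = c + 1 := ⟨b - 1, by omega⟩
      obtain rfl : i = c + 2 := by omega
      exact hab.right (hsep c (hab.mem _ (by omega) (by omega)) h)
  have hmid : weight U' b = weight U' a + (runWeight (p - 2 - a) + runWeight (b - p - 2)) := by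
    have key : ∀ c d, c ≤ d → a ≤ c → d ≤ b → p ≤ c + 1 → d ≤ p + 1 →
        c ∉ U' → weight U' d = weight U' c := by
      intro c d hcd hac hdb hpc hdp hc
      obtain ⟨k, rfl⟩ := Nat.exists_eq_add_of_le hcd
      clear hcd
      induction k with
      | zero => rfl
      | succ k ih =>
        rw [← add_assoc, weight_succ_of_notMem, ih (by omega) (by omega)]
        intro hm
        have := ((hU' _).1 hm).2
        omega
    have hleft : weight U' (max a (p - 1)) = weight U' a + runWeight (p - 2 - a) := by
      rcases Nat.lt_or_ge a (p - 1) with hlt | hge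
      · have hrun : IsRun U' a (p - 1) := by
          refine ⟨ha', fun h => ?_, hlt, fun j hj hjp =>
            (hU' j).2 ⟨hab.mem j hj (by omega), by omega⟩⟩
          have := ((hU' _).1 h).2
          omega
        rw [max_eq_right hlt.le, hrun.weight_eq]
        congr 2
        omega
      · rw [max_eq_left hge, runWeight_of_le_one (by omega : p - 2 - a ≤ 1), add_zero]
    have hright : weight U' b = weight U' (min b (p + 1)) + runWeight (b - p - 2) := by
      rcases Nat.lt_or_ge (p + 1) b with hlt | hge
      · have hrun : IsRun U' (p + 1) b := by
          refine ⟨fun h => ?_, hb', hlt, fun j hj hjb =>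
            (hU' j).2 ⟨hab.mem j (by omega) hjb, by omega⟩⟩
          have := ((hU' _).1 h).2
          omega
        rw [min_eq_right hlt.le, hrun.weight_eq]
        congr 2
      · rw [min_eq_left hge, runWeight_of_le_one (by omega : b - p - 2 ≤ 1), add_zero]
    rw [hright, key (max a (p - 1)) (min b (p + 1)) (by omega) (by omega) (by omega) (by omega)
      (by omega), hleft, add_assoc]
    intro hm
    rcases max_choice a (p - 1) with h | h
    · exact ha' (h ▸ hm)
    · have := ((hU' _).1 hm).2
      omega
  have := hab.weight_eq
  omega

variable {n : ℕ}

/-- The undominated vertices, numbered from `1`. -/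
def undominated (X : Set (Fin n)) : Set ℕ :=
  {i | ∃ x : Fin n, x.val + 1 = i ∧ x ∉ closedNbhdSet (pathGraph n) X}

lemma mem_closedNbhdSet_pathGraph {X : Set (Fin n)} {u : Fin n} :
    u ∈ closedNbhdSet (pathGraph n) X ↔ ∃ x ∈ X, x.val ≤ u.val + 1 ∧ u.val ≤ x.val + 1 := by
  simp only [closedNbhdSet, Set.mem_ofPred_eq, pathGraph_adj]
  constructor
  · rintro (h | ⟨x, hx, h⟩)
    · exact ⟨u, h, by omega, by omega⟩
    · exact ⟨x, hx, by omega, by omega⟩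
  · rintro ⟨x, hx, h1, h2⟩
    by_cases hux : u = x
    · exact Or.inl (hux ▸ hx)
    · exact Or.inr ⟨x, hx, by omega⟩

lemma mem_undominated {X : Set (Fin n)} {i : ℕ} :
    i ∈ undominated X ↔ 0 < i ∧ i ≤ n ∧ ∀ x ∈ X, i < x.val ∨ x.val + 2 < i := by
  simp only [undominated, Set.mem_ofPred_eq, mem_closedNbhdSet_pathGraph, not_exists, not_and]
  constructor
  · rintro ⟨x, rfl, h⟩
    refine ⟨by omega, x.isLt, fun y hy => ?_⟩
    have := h y hy
    omega
  · rintro ⟨h0, hn, h⟩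
    refine ⟨⟨i - 1, by omega⟩, by simp only; omega, fun y hy => ?_⟩
    have := h y hy
    simp only
    omega

lemma succ_mem_undominated {X : Set (Fin n)} {u : Fin n} :
    u.val + 1 ∈ undominated X ↔ u ∉ closedNbhdSet (pathGraph n) X := by
  constructor
  · rintro ⟨x, hx, h⟩
    rwa [show u = x from Fin.ext (by omega)]
  · exact fun h => ⟨u, rfl, h⟩

lemma zero_notMem_undominated (X : Set (Fin n)) : 0 ∉ undominated X :=
  fun h => absurd (mem_undominated.1 h).1 (lt_irrefl 0)

lemma notMem_undominated_of_lt (X : Set (Fin n)) (j : ℕ) (hj : n + 1 ≤ j) :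
    j ∉ undominated X := fun h => by
  have := (mem_undominated.1 h).2.1
  omega

lemma undominated_separated (X : Set (Fin n)) (i : ℕ) (h : i ∈ undominated X)
    (h' : i + 2 ∈ undominated X) : i + 1 ∈ undominated X := by
  rw [mem_undominated] at *
  refine ⟨by omega, by omega, fun x hx => ?_⟩
  have := h.2.2 x hx
  have := h'.2.2 x hx
  omega

lemma mem_undominated_insert {X : Set (Fin n)} {v : Fin n} (i : ℕ) :
    i ∈ undominated (insert v X) ↔
      i ∈ undominated X ∧ (i + 1 < v.val + 1 ∨ v.val + 1 + 1 < i) := by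
  simp only [mem_undominated, Set.forall_mem_insert]
  constructor
  · rintro ⟨h0, hn, h, h'⟩
    exact ⟨⟨h0, hn, h'⟩, by omega⟩
  · rintro ⟨⟨h0, hn, h'⟩, h⟩
    exact ⟨h0, hn, by omega, h'⟩

lemma finite_undominated (X : Set (Fin n)) : (undominated X).Finite :=
  (Set.finite_Iic n).subset fun _ h => (mem_undominated.1 h).2.1

lemma exists_run_of_isPlayable {X : Set (Fin n)} {v : Fin n}
    (h : IsPlayable (pathGraph n) X v) :
    ∃ a b, IsRun (undominated X) a b ∧ a + 3 ≤ b ∧ a ≤ v.val + 1 ∧ v.val + 1 ≤ b ∧ b ≤ n + 1 := by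
  obtain ⟨u, huv, hu, w, huw, hw⟩ := h
  rw [← succ_mem_undominated] at hu hw
  obtain ⟨a, b, hab, h1, h2, h3⟩ := exists_run (zero_notMem_undominated X)
    (notMem_undominated_of_lt X) hu
  have huv' : u.val ≤ v.val + 1 ∧ v.val ≤ u.val + 1 := by
    rcases huv with rfl | huv
    · omega
    · rw [pathGraph_adj] at huv
      omega
  have hwa : w.val + 1 ≠ a := fun h => hab.left (h ▸ hw)
  have hwb : w.val + 1 ≠ b := fun h => hab.right (h ▸ hw)
  rw [pathGraph_adj] at huw
  exact ⟨a, b, hab, by omega, by omega, by omega, h3⟩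

lemma isPlayable_of_adjacent {X : Set (Fin n)} {v : Fin n} {i j : ℕ} (hi : i ∈ undominated X)
    (hj : j ∈ undominated X) (hij : i + 1 = j ∨ j + 1 = i) (hv : v.val ≤ i) (hv' : i ≤ v.val + 2) :
    IsPlayable (pathGraph n) X v := by
  obtain ⟨x, rfl, hx⟩ := hi
  obtain ⟨y, rfl, hy⟩ := hj
  refine ⟨x, ?_, hx, y, by rw [pathGraph_adj]; omega, hy⟩
  by_cases h : x = v
  · exact Or.inl h
  · rw [pathGraph_adj]
    have : x.val ≠ v.val := fun h' => h (Fin.ext h')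
    omega

/-- The weight of a position of the isolation game on the path, in eighths of a move. -/
noncomputable def potential (X : Set (Fin n)) : ℕ := weight (undominated X) (n + 1)

lemma IsRun.potential_insert {X : Set (Fin n)} {v : Fin n} {a b : ℕ}
    (hab : IsRun (undominated X) a b) (h3 : a + 3 ≤ b) (hav : a ≤ v.val + 1)
    (hvb : v.val + 1 ≤ b) (hbn : b ≤ n + 1) :
    potential X + (runWeight (v.val + 1 - 2 - a) + runWeight (b - (v.val + 1) - 2)) =
      potential (insert v X) + runWeight (b - a - 1) :=
  hab.weight_split h3 (undominated_separated X) (zero_notMem_undominated X) hav hvb hbn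
    mem_undominated_insert

lemma potential_insert_bounds {X : Set (Fin n)} {v : Fin n}
    (h : IsPlayable (pathGraph n) X v) :
    potential (insert v X) < potential X ∧ potential X < potential (insert v X) + 16 := by
  obtain ⟨a, b, hab, h3, hav, hvb, hbn⟩ := exists_run_of_isPlayable h
  have h1 := hab.potential_insert h3 hav hvb hbn
  have h2 := runWeight_split (m := b - a - 1) (x := v.val + 1 - 2 - a)
    (y := b - (v.val + 1) - 2) (by omega) (by omega)
  omega

lemma exists_urgent_run {X : Set (Fin n)} (h : ∃ v, IsPlayable (pathGraph n) X v) :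
    ∃ a b, IsRun (undominated X) a b ∧ a + 3 ≤ b ∧ b ≤ n + 1 ∧
      runGrain (b - a - 1) ∣ potential X := by
  let S : Set ℕ := {g | ∃ a b, IsRun (undominated X) a b ∧ a + 3 ≤ b ∧ b ≤ n + 1 ∧
    runGrain (b - a - 1) = g}
  have hS : S.Nonempty := by
    obtain ⟨v, hv⟩ := h
    obtain ⟨a, b, hab, h3, -, -, hbn⟩ := exists_run_of_isPlayable hv
    exact ⟨_, a, b, hab, h3, hbn, rfl⟩
  obtain ⟨a, b, hab, h3, hbn, hg⟩ := Nat.sInf_mem hS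
  refine ⟨a, b, hab, h3, hbn, dvd_weight (zero_notMem_undominated X) _
    (notMem_undominated_of_lt X _ le_rfl) fun c d hcd hdn => ?_⟩
  by_cases hc3 : c + 3 ≤ d
  · have hle : runGrain (b - a - 1) ≤ runGrain (d - c - 1) := by
      rw [hg]
      exact Nat.sInf_le ⟨c, d, hcd, hc3, hdn, rfl⟩
    refine Dvd.dvd.trans ?_ (runGrain_dvd_runWeight (by omega))
    rcases runGrain_cases (b - a - 1) with h1 | h1 | h1 | h1 <;>
      rcases runGrain_cases (d - c - 1) with h2 | h2 | h2 | h2 <;>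
      rw [h1, h2] at hle ⊢ <;> omega
  · rw [runWeight_of_le_one (by omega)]
    exact dvd_zero _

lemma exists_move_potential_le {X : Set (Fin n)} (h : ∃ v, IsPlayable (pathGraph n) X v) :
    ∃ v, IsPlayable (pathGraph n) X v ∧ (potential (insert v X) + 7) / 8 + 1 ≤ potential X / 8 := by
  obtain ⟨a, b, hab, h3, hbn, hg⟩ := exists_urgent_run h
  have hm : a + min 3 (b - a - 1) ∈ undominated X := hab.mem _ (by omega) (by omega)
  have hm' : a + min 3 (b - a - 1) - 1 ∈ undominated X := hab.mem _ (by omega) (by omega)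
  refine ⟨⟨a + min 3 (b - a - 1) - 1, by omega⟩,
    isPlayable_of_adjacent hm hm' (by omega) (by simp) (by simp only; omega), ?_⟩
  have h1 := hab.potential_insert (v := ⟨a + min 3 (b - a - 1) - 1, by omega⟩) h3
    (by simp only; omega) (by simp only; omega) hbn
  have h2 := runWeight_sub_four (m := b - a - 1) (by omega)
  simp only at h1
  rw [runWeight_of_le_one (m := _ - 2 - a) (by omega),
    show b - (a + min 3 (b - a - 1) - 1 + 1) - 2 = b - a - 1 - 4 by omega] at h1
  rcases runGrain_cases (b - a - 1) with h4 | h4 | h4 | h4 <;> rw [h4] at hg h2 <;> omega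

lemma exists_move_le_potential {X : Set (Fin n)} (hX : X.Nonempty)
    (h : ∃ v, IsPlayable (pathGraph n) X v) :
    ∃ v, IsPlayable (pathGraph n) X v ∧ (potential X + 7) / 8 ≤ potential (insert v X) / 8 + 1 := by
  obtain ⟨a, b, hab, h3, hbn, hg⟩ := exists_urgent_run h
  have h2 := runWeight_pred (m := b - a - 1) (by omega)
  have key : ∀ v : Fin n, runWeight (v.val + 1 - 2 - a) + runWeight (b - (v.val + 1) - 2) =
      runWeight (b - a - 1 - 1) → a ≤ v.val + 1 → v.val + 1 ≤ b →
      (potential X + 7) / 8 ≤ potential (insert v X) / 8 + 1 := by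
    intro v hv hav hvb
    have h1 := hab.potential_insert h3 hav hvb hbn
    rw [hv] at h1
    rcases runGrain_cases (b - a - 1) with h4 | h4 | h4 | h4 <;> rw [h4] at hg h2 <;> omega
  by_cases ha : a = 0
  · have hb : b ≤ n := by
      by_contra hc
      obtain ⟨x, hx⟩ := hX
      have := (mem_undominated.1 (hab.mem (x.val + 1) (by omega) (by omega))).2.2 x hx
      omega
    refine ⟨⟨b - 1, by omega⟩, isPlayable_of_adjacent (hab.mem (b - 1) (by omega) (by omega))
      (hab.mem (b - 2) (by omega) (by omega)) (by omega) le_rfl (by simp only; omega), ?_⟩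
    refine key _ ?_ (by simp only; omega) (by simp only; omega)
    simp only
    rw [runWeight_of_le_one (m := b - _ - 2) (by omega), add_zero]
    congr 1
    omega
  · refine ⟨⟨a - 1, by omega⟩, isPlayable_of_adjacent (hab.mem (a + 1) (by omega) (by omega))
      (hab.mem (a + 2) (by omega) (by omega)) (by omega) (by simp only; omega)
      (by simp only; omega), ?_⟩
    refine key _ ?_ (by simp only; omega) (by simp only; omega)
    simp only
    rw [runWeight_of_le_one (m := _ - 2 - a) (by omega), zero_add]
    congr 1
    omega

lemma potential_eq_zero {X : Set (Fin n)} (h : ¬ ∃ v, IsPlayable (pathGraph n) X v) :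
    potential X = 0 := by
  refine Nat.eq_zero_of_zero_dvd (dvd_weight (zero_notMem_undominated X) _
    (notMem_undominated_of_lt X _ le_rfl) fun a b hab hbn => ?_)
  rw [runWeight_of_le_one]
  by_contra hc
  have h1 := hab.mem (a + 1) (by omega) (by omega)
  have h2 := hab.mem (a + 2) (by omega) (by omega)
  exact h ⟨⟨a, by omega⟩, isPlayable_of_adjacent h1 h2 (by omega) (by simp) (by simp)⟩

lemma ncard_undominated_insert_lt {X : Set (Fin n)} {v : Fin n}
    (h : IsPlayable (pathGraph n) X v) :
    (undominated (insert v X)).ncard < (undominated X).ncard := by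
  refine Set.ncard_lt_ncard ?_ (finite_undominated X)
  refine ⟨fun i hi => ((mem_undominated_insert i).1 hi).1, fun hsub => ?_⟩
  obtain ⟨u, huv, hu, -⟩ := h
  have hm := ((mem_undominated_insert _).1 (hsub (succ_mem_undominated.2 hu))).2
  rcases huv with rfl | huv
  · omega
  · rw [pathGraph_adj] at huv
    omega

lemma isoGameVal_le_fuel {V : Type*} (G : SimpleGraph V) (k : ℕ) (p : Bool) (X : Set V) :
    isoGameVal G k p X ≤ k := by
  induction k generalizing p X with
  | zero => simp [isoGameVal]
  | succ k ih =>
    rw [isoGameVal]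
    split_ifs with h hp
    · obtain ⟨v, hv⟩ := h
      exact le_trans (Nat.sInf_le ⟨v, hv, rfl⟩) (Nat.succ_le_succ (ih _ _))
    · obtain ⟨v, hv⟩ := h
      refine csSup_le ⟨_, v, hv, rfl⟩ ?_
      rintro _ ⟨w, -, rfl⟩
      exact Nat.succ_le_succ (ih _ _)
    · exact Nat.zero_le _

lemma isoGameVal_staller_ge {V : Type*} {G : SimpleGraph V} {X : Set V} {v : V}
    (hv : IsPlayable G X v) (k : ℕ) :
    isoGameVal G k true (insert v X) + 1 ≤ isoGameVal G (k + 1) false X := by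
  rw [isoGameVal, if_pos ⟨v, hv⟩]
  refine le_csSup ⟨k + 1, ?_⟩ ⟨v, hv, rfl⟩
  rintro _ ⟨w, -, rfl⟩
  exact Nat.succ_le_succ (isoGameVal_le_fuel _ _ _ _)

lemma isoGameVal_le_potential (k : ℕ) (X : Set (Fin n)) :
    isoGameVal (pathGraph n) k true X ≤ potential X / 8 ∧
      isoGameVal (pathGraph n) k false X ≤ (potential X + 7) / 8 := by
  induction k generalizing X with
  | zero => simp [isoGameVal]
  | succ k ih =>
    by_cases h : ∃ v, IsPlayable (pathGraph n) X v
    · rw [isoGameVal, isoGameVal, if_pos h, if_pos h, if_pos rfl, if_neg Bool.false_ne_true]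
      constructor
      · obtain ⟨v, hv, hle⟩ := exists_move_potential_le h
        refine le_trans (Nat.sInf_le ⟨v, hv, rfl⟩) ?_
        exact (Nat.succ_le_succ (ih _).2).trans hle
      · obtain ⟨v, hv⟩ := h
        refine csSup_le ⟨_, v, hv, rfl⟩ ?_
        rintro _ ⟨w, hw, rfl⟩
        have h1 := (ih (insert w X)).1
        have h2 := (potential_insert_bounds hw).1
        simp only [Bool.not_false]
        omega
    · simp [isoGameVal, h]

lemma potential_div_eight_le_of_le {k : ℕ} {X : Set (Fin n)}
    (ih : ∀ v, IsPlayable (pathGraph n) X v →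
      (potential (insert v X) + 7) / 8 ≤ isoGameVal (pathGraph n) k false (insert v X)) :
    potential X / 8 ≤ isoGameVal (pathGraph n) (k + 1) true X := by
  by_cases h : ∃ v, IsPlayable (pathGraph n) X v
  · rw [isoGameVal, if_pos h, if_pos rfl]
    obtain ⟨v, hv⟩ := h
    refine le_csInf ⟨_, v, hv, rfl⟩ ?_
    rintro _ ⟨w, hw, rfl⟩
    have h1 := ih w hw
    have h2 := (potential_insert_bounds hw).2
    simp only [Bool.not_true]
    omega
  · simp [potential_eq_zero h]

lemma potential_le_isoGameVal (k : ℕ) (X : Set (Fin n)) (hX : X.Nonempty)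
    (hk : (undominated X).ncard ≤ k) :
    potential X / 8 ≤ isoGameVal (pathGraph n) k true X ∧
      (potential X + 7) / 8 ≤ isoGameVal (pathGraph n) k false X := by
  induction k generalizing X with
  | zero =>
    have : potential X = 0 := potential_eq_zero fun ⟨v, hv⟩ => by
      have := ncard_undominated_insert_lt hv
      omega
    simp [this]
  | succ k ih =>
    have ih' : ∀ v, IsPlayable (pathGraph n) X v → _ := fun v hv =>
      ih (insert v X) (Set.insert_nonempty v X) (by
        have := ncard_undominated_insert_lt hv
        omega)
    refine ⟨potential_div_eight_le_of_le fun v hv => (ih' v hv).2, ?_⟩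
    by_cases h : ∃ v, IsPlayable (pathGraph n) X v
    · obtain ⟨v, hv, hle⟩ := exists_move_le_potential hX h
      exact hle.trans ((Nat.succ_le_succ (ih' v hv).1).trans (isoGameVal_staller_ge hv k))
    · simp [potential_eq_zero h]

lemma isRun_undominated_empty : IsRun (undominated (∅ : Set (Fin n))) 0 (n + 1) :=
  ⟨zero_notMem_undominated _, notMem_undominated_of_lt _ _ le_rfl, by omega,
    fun j hj hjn => mem_undominated.2 ⟨hj, by omega, by simp⟩⟩

lemma potential_empty : potential (∅ : Set (Fin n)) = runWeight n := by
  rw [potential, isRun_undominated_empty.weight_eq]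
  simp [weight]

lemma ncard_undominated_le (X : Set (Fin n)) : (undominated X).ncard ≤ n := by
  have hsub : undominated X ⊆ Set.Icc 1 n := fun i hi =>
    ⟨(mem_undominated.1 hi).1, (mem_undominated.1 hi).2.1⟩
  simpa using Set.ncard_le_ncard hsub (Set.finite_Icc 1 n)

lemma iotaGame_pathGraph (hn : 0 < n) : iotaGame (pathGraph n) = runWeight n / 8 := by
  refine le_antisymm ?_ ?_
  · rw [← potential_empty]
    exact (isoGameVal_le_potential _ _).1
  · obtain ⟨k, rfl⟩ := Nat.exists_eq_add_of_le' hn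
    rw [← potential_empty, iotaGame, Fintype.card_fin]
    refine potential_div_eight_le_of_le fun v hv =>
      (potential_le_isoGameVal k _ (Set.insert_nonempty _ _) ?_).2
    have := ncard_undominated_insert_lt hv
    have := ncard_undominated_le (∅ : Set (Fin (k + 1)))
    omega

lemma iotaGame'_pathGraph_le : iotaGame' (pathGraph n) ≤ (runWeight n + 7) / 8 := by
  rw [← potential_empty]
  exact (isoGameVal_le_potential _ _).2

lemma le_iotaGame'_pathGraph (hn : 2 ≤ n) :
    runWeight (n - 2) / 8 + 1 ≤ iotaGame' (pathGraph n) := by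
  obtain ⟨k, rfl⟩ : ∃ k, n = k + 1 := ⟨n - 1, by omega⟩
  have h1 : 1 ∈ undominated (∅ : Set (Fin (k + 1))) :=
    isRun_undominated_empty.mem 1 (by omega) (by omega)
  have h2 : 2 ∈ undominated (∅ : Set (Fin (k + 1))) :=
    isRun_undominated_empty.mem 2 (by omega) (by omega)
  have hv : IsPlayable (pathGraph (k + 1)) ∅ 0 :=
    isPlayable_of_adjacent h1 h2 (by omega) (by simp) (by simp)
  have hpot := isRun_undominated_empty.potential_insert (v := (0 : Fin (k + 1))) (by omega)
    (by simp) (by simp) le_rfl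
  have hlt := ncard_undominated_insert_lt hv
  have hle := ncard_undominated_le (∅ : Set (Fin (k + 1)))
  have hval := (potential_le_isoGameVal k _ (Set.insert_nonempty 0 ∅) (by omega)).1
  have hmove := isoGameVal_staller_ge hv k
  rw [potential_empty] at hpot
  simp only [Fin.val_zero, zero_add, Nat.sub_zero, Nat.add_sub_cancel] at hpot
  rw [runWeight_of_le_one (by omega : 1 - 2 ≤ 1), zero_add] at hpot
  rw [iotaGame', Fintype.card_fin]
  omega

end PathIsolation

/-- Theorem 1.4: for `n ≥ 6` with `n ≡ 0 (mod 5)` or `n ≡ 4 (mod 5)`,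
`ι_g(P_n) = ⌈2n/5⌉ - 1` and `ι_g'(P_n) = ⌊(2n+2)/5⌋`.
(In ℕ, `⌈2n/5⌉ = (2n + 4) / 5`.) -/
theorem path_game_isolation_numbers (n : ℕ) (hn : 6 ≤ n)
    (h : n % 5 = 0 ∨ n % 5 = 4) :
    iotaGame (SimpleGraph.pathGraph n) = (2 * n + 4) / 5 - 1 ∧
    iotaGame' (SimpleGraph.pathGraph n) = (2 * n + 2) / 5 := by
  have h2 := PathIsolation.iotaGame'_pathGraph_le (n := n)
  have h3 := PathIsolation.le_iotaGame'_pathGraph (n := n) (by omega)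
  rw [PathIsolation.iotaGame_pathGraph (by omega)]
  unfold PathIsolation.runWeight at *
  rcases h with h | h
  · rw [show (n - 1) % 5 = 4 by omega] at *
    rw [show (n - 2 - 1) % 5 = 2 by omega] at *
    norm_num at *
    omega
  · rw [show (n - 1) % 5 = 3 by omega] at *
    rw [show (n - 2 - 1) % 5 = 1 by omega] at *
    norm_num at *
    omega
end
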